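/- (Elliptic partial fraction expansion.) Let [u] = q^{u²/r − u} Θ_{q^{2r}}(q^{2u}) with 0<q<1, r>0. Let n ≥ 1, 0 ≤ m ≤ n, and let v, u₁,…,uₙ be complex numbers that are generic (in particular [2m−n] ≠ 0, [v−u_a] ≠ 0 and [u_a−u_j] ≠ 0 for all a ≠ j). Then ∏_{k=1}^m ([v−u_k+1]/[v−u_k]) · ∏_{l=m+1}^n ([v−u_l−1]/[v−u_l]) = Σ_{a=1}^n ([v−u_a+2m−n]/([2m−n][v−u_a])) · (∏_{k=1}^m [u_a−u_k+1] ∏_{l=m+1}^n [u_a−u_l−1]) / ∏_{j=1, j≠a}^n [u_a−u_j]. -/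

import Mathlib

noncomputable def pinf (x p : ℂ) : ℂ := ∏' n : ℕ, (1 - x * p ^ n)

noncomputable def Theta (p z : ℂ) : ℂ := pinf z p * pinf (p / z) p * pinf p p

noncomputable def br (q r : ℝ) (u : ℂ) : ℂ :=
  (q : ℂ) ^ (u ^ 2 / (r : ℂ) - u) * Theta ((q : ℂ) ^ ((2 * r : ℝ) : ℂ)) ((q : ℂ) ^ (2 * u))


open Complex Filter Topology

/-- The finite `q`-Pochhammer symbol `(p; p)_k`. -/
noncomputable def qPoch (p : ℂ) (k : ℕ) : ℂ := ∏ i ∈ Finset.range k, (1 - p * p ^ i)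

/-- The reciprocal of `(p; p)_k`, extended by zero to negative `k`. -/
noncomputable def invQPoch (p : ℂ) (k : ℤ) : ℂ := if k < 0 then 0 else (qPoch p k.toNat)⁻¹

lemma one_sub_mul_pow_ne_zero {p : ℂ} (hp : ‖p‖ < 1) (i : ℕ) : 1 - p * p ^ i ≠ 0 := by
  intro h
  have h1 : ‖p ^ (i + 1)‖ < 1 := by
    rw [norm_pow]
    exact pow_lt_one₀ (norm_nonneg _) hp (by omega)
  rw [pow_succ', ← sub_eq_zero.mp h] at h1
  simp at h1

lemma qPoch_ne_zero {p : ℂ} (hp : ‖p‖ < 1) (k : ℕ) : qPoch p k ≠ 0 :=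
  Finset.prod_ne_zero_iff.mpr fun i _ ↦ one_sub_mul_pow_ne_zero hp i

lemma invQPoch_sub_one {p : ℂ} (hp : ‖p‖ < 1) (k : ℤ) :
    invQPoch p (k - 1) = (1 - p ^ k) * invQPoch p k := by
  rcases lt_trichotomy k 0 with hk | rfl | hk
  · simp [invQPoch, hk, show k - 1 < 0 by omega]
  · simp [invQPoch]
  · obtain ⟨j, rfl⟩ : ∃ j : ℕ, k = j + 1 := ⟨(k - 1).toNat, by omega⟩
    have h1 : ¬ ((j : ℤ) < 0) := by omega
    have h2 : ¬ ((j : ℤ) + 1 < 0) := by omega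
    have h3 : ((j : ℤ) + 1).toNat = j + 1 := by omega
    have h4 := one_sub_mul_pow_ne_zero hp j
    have h5 := qPoch_ne_zero hp j
    have h6 : p ^ ((j : ℤ) + 1) = p * p ^ j := by
      rw [← pow_succ']
      exact_mod_cast zpow_natCast p (j + 1)
    have h7 : qPoch p (j + 1) = qPoch p j * (1 - p * p ^ j) := Finset.prod_range_succ _ _
    simp only [invQPoch, add_sub_cancel_right, if_neg h1, if_neg h2, h3, h6, h7, Int.toNat_natCast]
    field_simp

lemma summable_norm_mul_pow (x : ℂ) {p : ℂ} (hp : ‖p‖ < 1) :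
    Summable fun n : ℕ ↦ ‖-(x * p ^ n)‖ := by
  simp only [norm_neg, norm_mul, norm_pow]
  exact (summable_geometric_of_lt_one (norm_nonneg _) hp).mul_left _

lemma tendsto_prod_pinf (x : ℂ) {p : ℂ} (hp : ‖p‖ < 1) :
    Tendsto (fun N ↦ ∏ k ∈ Finset.range N, (1 - x * p ^ k)) atTop (𝓝 (pinf x p)) := by
  have h := (multipliable_one_add_of_summable (summable_norm_mul_pow x hp)).hasProd.tendsto_prod_nat
  simpa only [← sub_eq_add_neg, pinf] using h

lemma pinf_self_ne_zero {p : ℂ} (hp : ‖p‖ < 1) : pinf p p ≠ 0 := by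
  have h := tprod_one_add_ne_zero_of_summable (f := fun n : ℕ ↦ -(p * p ^ n))
    (fun i ↦ by simpa only [← sub_eq_add_neg] using one_sub_mul_pow_ne_zero hp i)
    (summable_norm_mul_pow p hp)
  simpa only [← sub_eq_add_neg, pinf] using h

lemma tendsto_qPoch {p : ℂ} (hp : ‖p‖ < 1) : Tendsto (qPoch p) atTop (𝓝 (pinf p p)) :=
  tendsto_prod_pinf p hp

lemma tendsto_invQPoch {p : ℂ} (hp : ‖p‖ < 1) :
    Tendsto (invQPoch p) atTop (𝓝 (pinf p p)⁻¹) := by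
  have h : Tendsto (fun k : ℤ ↦ (qPoch p k.toNat)⁻¹) atTop (𝓝 (pinf p p)⁻¹) :=
    ((tendsto_qPoch hp).inv₀ (pinf_self_ne_zero hp)).comp
      (tendsto_atTop_atTop.mpr fun b ↦ ⟨b, fun a ha ↦ by omega⟩)
  refine h.congr' ?_
  filter_upwards [eventually_ge_atTop 0] with k hk
  simp [invQPoch, not_lt.mpr hk]

lemma exists_norm_qPoch_le {p : ℂ} (hp : ‖p‖ < 1) : ∃ C, ∀ k, ‖qPoch p k‖ ≤ C := by
  obtain ⟨C, hC⟩ := (Metric.isBounded_range_of_tendsto _ (tendsto_qPoch hp)).exists_norm_le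
  exact ⟨C, fun k ↦ hC _ ⟨k, rfl⟩⟩

lemma exists_norm_invQPoch_le {p : ℂ} (hp : ‖p‖ < 1) : ∃ C, ∀ k, ‖invQPoch p k‖ ≤ C := by
  obtain ⟨C, hC⟩ := (Metric.isBounded_range_of_tendsto _
    ((tendsto_qPoch hp).inv₀ (pinf_self_ne_zero hp))).exists_norm_le
  refine ⟨C, fun k ↦ ?_⟩
  have hC0 : 0 ≤ C := (norm_nonneg _).trans (hC _ ⟨0, rfl⟩)
  unfold invQPoch
  split_ifs
  · simpa using hC0
  · exact hC _ ⟨k.toNat, rfl⟩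

/-- The central `q`-binomial coefficient `[2N choose N + n]`, for any integer `n`. -/
noncomputable def qBinom (p : ℂ) (N : ℕ) (n : ℤ) : ℂ :=
  qPoch p (2 * N) * (invQPoch p (N + n) * invQPoch p (N - n))

lemma qBinom_succ {p : ℂ} (hp0 : p ≠ 0) (hp : ‖p‖ < 1) (N : ℕ) (n : ℤ) :
    qBinom p (N + 1) n = (1 + p ^ (2 * N + 1)) * qBinom p N n
      + p ^ (N + 1) / p ^ n * qBinom p N (n - 1) + p ^ (N + 1) * p ^ n * qBinom p N (n + 1) := by
  set A := invQPoch p (N + n + 1) with hA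
  set B := invQPoch p (N - n + 1) with hB
  have hX : p ^ n ≠ 0 := zpow_ne_zero _ hp0
  have a1 : invQPoch p (N + n) = (1 - p ^ N * p ^ n * p) * A := by
    have h := invQPoch_sub_one hp (N + n + 1)
    rwa [add_sub_cancel_right, zpow_add₀ hp0, zpow_add₀ hp0, zpow_natCast, zpow_one] at h
  have b1 : invQPoch p (N - n) = (1 - p ^ N / p ^ n * p) * B := by
    have h := invQPoch_sub_one hp (N - n + 1)
    rwa [add_sub_cancel_right, zpow_add₀ hp0, zpow_sub₀ hp0, zpow_natCast, zpow_one] at h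
  have a2 : invQPoch p (N + (n - 1)) = (1 - p ^ N * p ^ n) * ((1 - p ^ N * p ^ n * p) * A) := by
    have h := invQPoch_sub_one hp (N + n)
    rwa [a1, zpow_add₀ hp0, zpow_natCast, ← add_sub_assoc'] at h
  have b2 : invQPoch p (N - (n + 1)) = (1 - p ^ N / p ^ n) * ((1 - p ^ N / p ^ n * p) * B) := by
    have h := invQPoch_sub_one hp (N - n)
    rwa [b1, zpow_sub₀ hp0, zpow_natCast, sub_sub] at h
  have a3 : invQPoch p (N + (n + 1)) = A := by rw [hA, add_assoc]
  have b3 : invQPoch p (N - (n - 1)) = B := by rw [hB]; congr 1; ring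
  have a4 : invQPoch p ((N + 1 : ℕ) + n) = A := by rw [hA]; congr 1; push_cast; ring
  have b4 : invQPoch p ((N + 1 : ℕ) - n) = B := by rw [hB]; congr 1; push_cast; ring
  have hP : qPoch p (2 * (N + 1))
      = qPoch p (2 * N) * (1 - p * p ^ (2 * N)) * (1 - p * p ^ (2 * N + 1)) := by
    rw [show 2 * (N + 1) = 2 * N + 1 + 1 by ring]
    simp only [qPoch, Finset.prod_range_succ]
  simp only [qBinom, a1, a2, a3, a4, b1, b2, b3, b4, hP]
  have e : p ^ (2 * N) = p ^ N * p ^ N := by rw [two_mul, pow_add]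
  simp only [pow_succ, e]
  field_simp
  ring

/-- The nome `exp(2πiτ)` has norm less than one. -/
lemma norm_cexp_two_pi_I_lt_one {τ : ℂ} (hτ : 0 < τ.im) : ‖cexp (2 * Real.pi * I * τ)‖ < 1 :=
  UpperHalfPlane.norm_exp_two_pi_I_lt_one ⟨τ, hτ⟩

lemma jacobiTheta₂_term_add_one (n : ℤ) (z τ : ℂ) :
    jacobiTheta₂_term (n + 1) (z + 1 / 2 - τ / 2) τ =
      -(cexp (2 * Real.pi * I * z) * cexp (2 * Real.pi * I * τ) ^ n)
        * jacobiTheta₂_term n (z + 1 / 2 - τ / 2) τ := by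
  rw [← exp_int_mul, ← neg_one_mul, ← exp_pi_mul_I]
  simp only [jacobiTheta₂_term, ← Complex.exp_add]
  congr 1
  push_cast
  ring

lemma hasSum_finite_triple_product (z : ℂ) {τ : ℂ} (hτ : 0 < τ.im) (N : ℕ) :
    let p := cexp (2 * Real.pi * I * τ)
    let x := cexp (2 * Real.pi * I * z)
    HasSum (fun n : ℤ ↦ qBinom p N n * jacobiTheta₂_term n (z + 1 / 2 - τ / 2) τ)
      ((∏ k ∈ Finset.range N, (1 - x * p ^ k)) * ∏ k ∈ Finset.range N, (1 - p / x * p ^ k)) := by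
  intro p x
  have hp := norm_cexp_two_pi_I_lt_one hτ
  have hp0 : p ≠ 0 := exp_ne_zero _
  have hx0 : x ≠ 0 := exp_ne_zero _
  have hstep (n : ℤ) : jacobiTheta₂_term (n + 1) (z + 1 / 2 - τ / 2) τ =
      -(x * p ^ n) * jacobiTheta₂_term n (z + 1 / 2 - τ / 2) τ := jacobiTheta₂_term_add_one n z τ
  set T := fun n : ℤ ↦ jacobiTheta₂_term n (z + 1 / 2 - τ / 2) τ
  change ∀ n, T (n + 1) = -(x * p ^ n) * T n at hstep
  change HasSum (fun n : ℤ ↦ qBinom p N n * T n) _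
  induction N with
  | zero =>
    have h0 : qBinom p 0 0 * T 0 = 1 := by
      simp [T, qBinom, qPoch, invQPoch, jacobiTheta₂_term]
    have := hasSum_single (f := fun n : ℤ ↦ qBinom p 0 n * T n) 0 (fun n hn ↦ by
      rcases lt_or_gt_of_ne hn with h | h <;> simp [qBinom, invQPoch, h])
    simpa [h0] using this
  | succ N ih =>
    have hm := ((Equiv.subRight (1 : ℤ)).hasSum_iff).mpr ih
    have hq := ((Equiv.addRight (1 : ℤ)).hasSum_iff).mpr ih
    have hcoef (n : ℤ) : qBinom p (N + 1) n * T n = (1 + p ^ (2 * N + 1)) * (qBinom p N n * T n)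
        - x * p ^ N * (qBinom p N (n - 1) * T (n - 1))
        - p ^ (N + 1) / x * (qBinom p N (n + 1) * T (n + 1)) := by
      have h1 := hstep (n - 1)
      have hX : p ^ n ≠ 0 := zpow_ne_zero _ hp0
      rw [sub_add_cancel, zpow_sub_one₀ hp0] at h1
      rw [qBinom_succ hp0 hp, hstep n, h1]
      field_simp
      ring
    simp only [hcoef]
    have := ((ih.mul_left (1 + p ^ (2 * N + 1))).sub (hm.mul_left (x * p ^ N))).sub
      (hq.mul_left (p ^ (N + 1) / x))
    refine (congrArg (fun a ↦ HasSum _ a) ?_).mpr this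
    simp only [Finset.prod_range_succ]
    field_simp
    ring

/-- The **Jacobi triple product**: the theta product is Jacobi's two-variable theta series. -/
theorem Theta_eq_jacobiTheta₂ (z : ℂ) {τ : ℂ} (hτ : 0 < τ.im) :
    Theta (cexp (2 * Real.pi * I * τ)) (cexp (2 * Real.pi * I * z)) =
      jacobiTheta₂ (z + 1 / 2 - τ / 2) τ := by
  have hfin := fun N ↦ (hasSum_finite_triple_product z hτ N).tsum_eq
  have hp := norm_cexp_two_pi_I_lt_one hτ
  set p := cexp (2 * Real.pi * I * τ)
  set x := cexp (2 * Real.pi * I * z)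
  have hP := pinf_self_ne_zero hp
  obtain ⟨C, hC⟩ := exists_norm_qPoch_le hp
  obtain ⟨D, hD⟩ := exists_norm_invQPoch_le hp
  have hC0 : 0 ≤ C := (norm_nonneg _).trans (hC 0)
  have hD0 : 0 ≤ D := (norm_nonneg _).trans (hD 0)
  have hlim : Tendsto (fun N : ℕ ↦ ∑' n : ℤ, qBinom p N n *
      jacobiTheta₂_term n (z + 1 / 2 - τ / 2) τ) atTop
      (𝓝 (∑' n : ℤ, pinf p p * ((pinf p p)⁻¹ * (pinf p p)⁻¹) *
        jacobiTheta₂_term n (z + 1 / 2 - τ / 2) τ)) := by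
    refine tendsto_tsum_of_dominated_convergence
      (bound := fun n ↦ C * (D * D) * ‖jacobiTheta₂_term n (z + 1 / 2 - τ / 2) τ‖)
      (((summable_jacobiTheta₂_term_iff _ _).mpr hτ).norm.mul_left _) (fun n ↦ ?_)
      (Eventually.of_forall fun N n ↦ ?_)
    · refine Tendsto.mul_const _ (Tendsto.mul ?_ (Tendsto.mul ?_ ?_))
      · exact (tendsto_qPoch hp).comp (tendsto_atTop_atTop.mpr fun b ↦ ⟨b, fun a ha ↦ by omega⟩)
      · exact (tendsto_invQPoch hp).comp
          (tendsto_atTop_atTop.mpr fun b ↦ ⟨(b - n).toNat, fun a ha ↦ by omega⟩)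
      · exact (tendsto_invQPoch hp).comp
          (tendsto_atTop_atTop.mpr fun b ↦ ⟨(b + n).toNat, fun a ha ↦ by omega⟩)
    · simp only [qBinom, norm_mul]
      gcongr <;> apply_rules
  have hprod := (tendsto_prod_pinf x hp).mul (tendsto_prod_pinf (p / x) hp)
  have h := tendsto_nhds_unique hprod (hlim.congr hfin)
  rw [tsum_mul_left] at h
  rw [Theta, h, jacobiTheta₂]
  field_simp

/-- The Gaussian series `∑ exp(a(n + b)²)`. -/
noncomputable def gaussianSum (a b : ℂ) : ℂ := ∑' n : ℤ, cexp (a * (n + b) ^ 2)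

lemma cexp_gauss_eq_jacobiTheta₂_term (a b : ℂ) (n : ℤ) :
    cexp (a * (n + b) ^ 2) =
      cexp (a * b ^ 2) * jacobiTheta₂_term n (a * b / (Real.pi * I)) (a / (Real.pi * I)) := by
  have hpi : (Real.pi : ℂ) ≠ 0 := ofReal_ne_zero.mpr Real.pi_ne_zero
  rw [jacobiTheta₂_term, ← Complex.exp_add]
  congr 1
  field_simp [I_ne_zero]
  ring

lemma im_div_pi_mul_I_pos {a : ℂ} (ha : a.re < 0) : 0 < (a / (Real.pi * I)).im := by
  have : a / (Real.pi * I) = (-(1 / Real.pi) : ℝ) * (a * I) := by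
    have hpi : (Real.pi : ℂ) ≠ 0 := ofReal_ne_zero.mpr Real.pi_ne_zero
    push_cast
    field_simp [I_ne_zero]
    linear_combination a * I_sq
  rw [this, im_ofReal_mul]
  have := Real.pi_pos
  simp only [mul_im, I_re, I_im, mul_one, mul_zero]
  have : 0 < 1 / Real.pi := by positivity
  nlinarith

lemma summable_gauss {a : ℂ} (ha : a.re < 0) (b : ℂ) :
    Summable fun n : ℤ ↦ cexp (a * (n + b) ^ 2) := by
  simp only [cexp_gauss_eq_jacobiTheta₂_term]
  exact ((summable_jacobiTheta₂_term_iff _ _).mpr (im_div_pi_mul_I_pos ha)).mul_left _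

lemma gaussianSum_add_one (a b : ℂ) : gaussianSum a (b + 1) = gaussianSum a b := by
  rw [gaussianSum, gaussianSum,
    ← (Equiv.addRight (1 : ℤ)).tsum_eq fun n : ℤ ↦ cexp (a * (n + b) ^ 2)]
  refine tsum_congr fun n ↦ ?_
  simp only [Equiv.coe_addRight]
  push_cast
  congr 2
  ring

/-- The alternating Gaussian series `∑ (-1)ⁿ exp(a(n + b)²)`. -/
noncomputable def altGaussianSum (a b : ℂ) : ℂ := ∑' n : ℤ, (-1) ^ n * cexp (a * (n + b) ^ 2)

/-- Splitting pairs of integers `(m, n)` by the parity of `m + n`. -/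
def intPairParityEquiv : (ℤ × ℤ) ⊕ (ℤ × ℤ) ≃ ℤ × ℤ where
  toFun
    | .inl x => (x.1 + x.2, x.1 - x.2)
    | .inr x => (x.1 + x.2 + 1, x.1 - x.2)
  invFun x :=
    if (x.1 + x.2) % 2 = 0 then .inl ((x.1 + x.2) / 2, (x.1 - x.2) / 2)
    else .inr ((x.1 + x.2) / 2, (x.1 - x.2) / 2)
  left_inv := by
    rintro (⟨i, k⟩ | ⟨i, k⟩)
    · dsimp only
      rw [if_pos (by omega)]
      congr 2 <;> omega
    · dsimp only
      rw [if_neg (by omega)]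
      congr 2 <;> omega
  right_inv := by
    rintro ⟨m, n⟩
    dsimp only
    split_ifs <;> ext <;> dsimp only <;> omega

lemma hasSum_of_parity {g : ℤ × ℤ → ℂ} {A B : ℂ}
    (hA : HasSum (fun x : ℤ × ℤ ↦ g (x.1 + x.2, x.1 - x.2)) A)
    (hB : HasSum (fun x : ℤ × ℤ ↦ g (x.1 + x.2 + 1, x.1 - x.2)) B) : HasSum g (A + B) :=
  intPairParityEquiv.hasSum_iff.mp (HasSum.sum (f := g ∘ intPairParityEquiv) hA hB)

lemma hasSum_mul_of_summable {f g : ℤ → ℂ} (hf : Summable f) (hg : Summable g) :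
    HasSum (fun x : ℤ × ℤ ↦ f x.1 * g x.2) ((∑' n, f n) * ∑' n, g n) :=
  hf.hasSum.mul hg.hasSum (summable_mul_of_summable_norm hf.norm hg.norm)

/-- A product of two alternating Gaussian series splits by the parity of the summation indices. -/
lemma altGaussianSum_mul {a : ℂ} (ha : a.re < 0) (s t : ℂ) :
    altGaussianSum a s * altGaussianSum a t =
      gaussianSum (2 * a) ((s + t) / 2) * gaussianSum (2 * a) ((s - t) / 2) -
        gaussianSum (2 * a) ((s + t) / 2 + 1 / 2) * gaussianSum (2 * a) ((s - t) / 2 + 1 / 2) := by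
  have ha2 : (2 * a).re < 0 := by
    rw [show (2 * a).re = 2 * a.re by simp]
    linarith
  have hG (b c : ℂ) : HasSum (fun x : ℤ × ℤ ↦
      cexp (2 * a * (x.1 + b) ^ 2) * cexp (2 * a * (x.2 + c) ^ 2))
      (gaussianSum (2 * a) b * gaussianSum (2 * a) c) :=
    hasSum_mul_of_summable (summable_gauss ha2 b) (summable_gauss ha2 c)
  have hn (b : ℂ) : Summable fun n : ℤ ↦ (-1) ^ n * cexp (a * (n + b) ^ 2) :=
    .of_norm (by simpa using (summable_gauss ha b).norm)
  have hA := hasSum_mul_of_summable (hn s) (hn t)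
  refine hA.unique ?_
  rw [sub_eq_add_neg]
  refine hasSum_of_parity ?_ ?_
  · refine (congrArg (fun h ↦ HasSum h _) (funext fun x ↦ ?_)).mpr (hG ((s + t) / 2) ((s - t) / 2))
    have hs : (-1 : ℂ) ^ (x.1 + x.2) * (-1) ^ (x.1 - x.2) = 1 := by
      rw [← zpow_add₀ (by norm_num)]
      exact Even.neg_one_zpow ⟨x.1, by ring⟩
    rw [mul_mul_mul_comm, hs, one_mul, ← Complex.exp_add, ← Complex.exp_add]
    congr 1
    push_cast
    ring
  · refine (congrArg (fun h ↦ HasSum h _) (funext fun x ↦ ?_)).mpr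
      (hG ((s + t) / 2 + 1 / 2) ((s - t) / 2 + 1 / 2)).neg
    have hs : (-1 : ℂ) ^ (x.1 + x.2 + 1) * (-1) ^ (x.1 - x.2) = -1 := by
      rw [← zpow_add₀ (by norm_num)]
      exact Odd.neg_one_zpow ⟨x.1, by ring⟩
    rw [mul_mul_mul_comm, hs, neg_one_mul, ← Complex.exp_add, ← Complex.exp_add]
    congr 2
    push_cast
    ring

lemma br_eq_jacobiTheta₂ {q r : ℝ} (hq0 : 0 < q) (hq1 : q < 1) (hr : 0 < r) (u : ℂ) :
    br q r u = cexp (Real.log q * (u ^ 2 / r - u)) *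
      jacobiTheta₂ (Real.log q * u / (Real.pi * I) + 1 / 2
        - (Real.log q * r : ℝ) / (Real.pi * I) / 2) ((Real.log q * r : ℝ) / (Real.pi * I)) := by
  have hτ : 0 < (((Real.log q * r : ℝ) : ℂ) / (Real.pi * I)).im := by
    apply im_div_pi_mul_I_pos
    rw [ofReal_re]
    exact mul_neg_of_neg_of_pos (Real.log_neg hq0 hq1) hr
  have hpi : (Real.pi : ℂ) ≠ 0 := ofReal_ne_zero.mpr Real.pi_ne_zero
  have hq : (q : ℂ) ≠ 0 := ofReal_ne_zero.mpr hq0.ne'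
  rw [← Theta_eq_jacobiTheta₂ _ hτ, br]
  simp only [cpow_def_of_ne_zero hq, ← ofReal_log hq0.le]
  congr 3
  · push_cast
    field_simp [I_ne_zero]
  · field_simp [I_ne_zero]

lemma br_eq_altGaussianSum {q r : ℝ} (hq0 : 0 < q) (hq1 : q < 1) (hr : 0 < r) (u : ℂ) :
    br q r u = cexp (-(Real.log q * r / 4)) *
      altGaussianSum ((Real.log q * r : ℝ) : ℂ) (u / r - 1 / 2) := by
  rw [br_eq_jacobiTheta₂ hq0 hq1 hr, altGaussianSum, jacobiTheta₂, ← tsum_mul_left, ← tsum_mul_left]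
  refine tsum_congr fun n ↦ ?_
  have hpi : (Real.pi : ℂ) ≠ 0 := ofReal_ne_zero.mpr Real.pi_ne_zero
  have hr' : (r : ℂ) ≠ 0 := ofReal_ne_zero.mpr hr.ne'
  rw [← exp_pi_mul_I, ← exp_int_mul, jacobiTheta₂_term]
  simp only [← Complex.exp_add]
  congr 1
  push_cast
  field_simp [I_ne_zero]
  ring

lemma differentiable_br {q r : ℝ} (hq0 : 0 < q) (hq1 : q < 1) (hr : 0 < r) :
    Differentiable ℂ (br q r) := by
  have hτ : 0 < (((Real.log q * r : ℝ) : ℂ) / (Real.pi * I)).im := by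
    apply im_div_pi_mul_I_pos
    rw [ofReal_re]
    exact mul_neg_of_neg_of_pos (Real.log_neg hq0 hq1) hr
  have hθ : Differentiable ℂ fun z ↦ jacobiTheta₂ z ((Real.log q * r : ℝ) / (Real.pi * I)) :=
    fun z ↦ differentiableAt_jacobiTheta₂_fst z hτ
  rw [funext (br_eq_jacobiTheta₂ hq0 hq1 hr)]
  exact Differentiable.mul (by fun_prop) (hθ.comp (g := fun z ↦ jacobiTheta₂ z _) (by fun_prop))

/-- The product `[x+z][x-z]` is an antisymmetric form of rank two in `x` and `z`. -/
lemma br_add_mul_br_sub {q r : ℝ} (hq0 : 0 < q) (hq1 : q < 1) (hr : 0 < r) (x z : ℂ) :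
    let G := gaussianSum (2 * (Real.log q * r : ℝ))
    br q r (x + z) * br q r (x - z) = cexp (-(Real.log q * r / 4)) ^ 2 *
      (G (x / r + 1 / 2) * G (z / r) - G (x / r) * G (z / r + 1 / 2)) := by
  intro G
  have ha : (((Real.log q * r : ℝ)) : ℂ).re < 0 := by
    rw [ofReal_re]
    exact mul_neg_of_neg_of_pos (Real.log_neg hq0 hq1) hr
  have h := altGaussianSum_mul ha ((x + z) / r - 1 / 2) ((x - z) / r - 1 / 2)
  rw [show ((x + z) / r - 1 / 2 + ((x - z) / r - 1 / 2)) / 2 = x / r - 1 / 2 by ring,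
    show ((x + z) / r - 1 / 2 - ((x - z) / r - 1 / 2)) / 2 = z / r by ring,
    sub_add_cancel, ← gaussianSum_add_one _ (x / r - 1 / 2),
    show x / r - 1 / 2 + 1 = x / r + 1 / 2 by ring] at h
  rw [br_eq_altGaussianSum hq0 hq1 hr, br_eq_altGaussianSum hq0 hq1 hr, mul_mul_mul_comm, h, sq]

lemma br_three_term {q r : ℝ} (hq0 : 0 < q) (hq1 : q < 1) (hr : 0 < r) (x y z w : ℂ) :
    br q r (x + z) * br q r (x - z) * (br q r (y + w) * br q r (y - w))
      - br q r (x + w) * br q r (x - w) * (br q r (y + z) * br q r (y - z))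
    = br q r (x + y) * br q r (x - y) * (br q r (z + w) * br q r (z - w)) := by
  simp only [br_add_mul_br_sub hq0 hq1 hr]
  ring

lemma br_neg {q r : ℝ} (hq0 : 0 < q) (hq1 : q < 1) (hr : 0 < r) (u : ℂ) :
    br q r (-u) = -br q r u := by
  by_cases h : ∀ s, br q r s = 0
  · simp [h]
  push Not at h
  obtain ⟨s, hs⟩ := h
  have h1 := br_add_mul_br_sub hq0 hq1 hr ((s + u) / 2) ((s - u) / 2)
  have h2 := br_add_mul_br_sub hq0 hq1 hr ((s - u) / 2) ((s + u) / 2)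
  rw [show (s + u) / 2 + (s - u) / 2 = s by ring,
    show (s + u) / 2 - (s - u) / 2 = u by ring] at h1
  rw [show (s - u) / 2 + (s + u) / 2 = s by ring,
    show (s - u) / 2 - (s + u) / 2 = -u by ring] at h2
  apply mul_left_cancel₀ hs
  rw [h2, mul_neg, h1]
  ring

lemma dense_br_ne_zero {q r : ℝ} (hq0 : 0 < q) (hq1 : q < 1) (hr : 0 < r) {s : ℂ}
    (hs : br q r s ≠ 0) : Dense {u | br q r u ≠ 0} := by
  have hd := differentiable_br hq0 hq1 hr
  refine dense_iff_inter_open.mpr fun U hU ⟨z, hz⟩ ↦ ?_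
  by_contra hne
  have hzero : br q r =ᶠ[𝓝 z] fun _ ↦ 0 := by
    filter_upwards [hU.mem_nhds hz] with w hw
    by_contra h
    exact hne ⟨w, hw, h⟩
  exact hs (congrFun (AnalyticOnNhd.eq_of_eventuallyEq (fun w _ ↦ hd.analyticAt w)
    (fun _ _ ↦ analyticAt_const) hzero) s)

section PartialFraction

variable {f : ℂ → ℂ}

/-- The three-term identity, written as a partial fraction expansion with poles at `a` and `c`. -/
lemma partialFraction_two_poles (hneg : ∀ x, f (-x) = -f x)
    (hthree : ∀ x y z w, f (x + z) * f (x - z) * (f (y + w) * f (y - w))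
      - f (x + w) * f (x - w) * (f (y + z) * f (y - z))
      = f (x + y) * f (x - y) * (f (z + w) * f (z - w)))
    {v a c b s : ℂ} (hs : f s ≠ 0) (hs' : f (s + c - b) ≠ 0) (hva : f (v - a) ≠ 0)
    (hvc : f (v - c) ≠ 0) (hac : f (a - c) ≠ 0) :
    f (v - a + s) / (f s * f (v - a)) * (f (v - b) / f (v - c)) =
      f (v - a + (s + c - b)) / (f (s + c - b) * f (v - a)) * (f (a - b) / f (a - c))
        + f (v - c + (s + c - b)) / (f (s + c - b) * f (v - c))
          * f (c - b) * (f (c - a + s) / (f s * f (c - a))) := by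
  have h := hthree ((v + (s + c - b) - b) / 2) ((s + c - b - v + b) / 2)
    ((v - 2 * a + (s + c - b) + b) / 2) ((v - 2 * c + (s + c - b) + b) / 2)
  rw [show (v + (s + c - b) - b) / 2 + (v - 2 * a + (s + c - b) + b) / 2 =
      v - a + (s + c - b) by ring,
    show (v + (s + c - b) - b) / 2 - (v - 2 * a + (s + c - b) + b) / 2 = a - b by ring,
    show (s + c - b - v + b) / 2 + (v - 2 * c + (s + c - b) + b) / 2 = s by ring,
    show (s + c - b - v + b) / 2 - (v - 2 * c + (s + c - b) + b) / 2 = -(v - c) by ring,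
    show (v + (s + c - b) - b) / 2 + (v - 2 * c + (s + c - b) + b) / 2 =
      v - c + (s + c - b) by ring,
    show (v + (s + c - b) - b) / 2 - (v - 2 * c + (s + c - b) + b) / 2 = c - b by ring,
    show (s + c - b - v + b) / 2 + (v - 2 * a + (s + c - b) + b) / 2 = c - a + s by ring,
    show (s + c - b - v + b) / 2 - (v - 2 * a + (s + c - b) + b) / 2 = -(v - a) by ring,
    show (v + (s + c - b) - b) / 2 + (s + c - b - v + b) / 2 = s + c - b by ring,
    show (v + (s + c - b) - b) / 2 - (s + c - b - v + b) / 2 = v - b by ring,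
    show (v - 2 * a + (s + c - b) + b) / 2 + (v - 2 * c + (s + c - b) + b) / 2 =
      v - a + s by ring,
    show (v - 2 * a + (s + c - b) + b) / 2 - (v - 2 * c + (s + c - b) + b) / 2 =
      -(a - c) by ring, hneg, hneg, hneg] at h
  rw [show c - a = -(a - c) by ring, hneg]
  rw [show c - a = -(a - c) by ring] at h
  field_simp
  linear_combination h

/-- The theta-type partial fraction expansion, for any continuous odd function satisfying
Weierstrass's three-term identity whose zero set has dense complement. -/
theorem partialFraction_of_three_term {ι : Type*} [DecidableEq ι] (hcont : Continuous f)
    (hdense : Dense {x | f x ≠ 0}) (hneg : ∀ x, f (-x) = -f x)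
    (hthree : ∀ x y z w, f (x + z) * f (x - z) * (f (y + w) * f (y - w))
      - f (x + w) * f (x - w) * (f (y + z) * f (y - z))
      = f (x + y) * f (x - y) * (f (z + w) * f (z - w)))
    {t : Finset ι} (ht : t.Nonempty) (u : ι → ℂ)
    (hu : ∀ a ∈ t, ∀ j ∈ t, a ≠ j → f (u a - u j) ≠ 0)
    (b : ι → ℂ) (hs : f (∑ i ∈ t, (u i - b i)) ≠ 0) (v : ℂ) (hv : ∀ a ∈ t, f (v - u a) ≠ 0) :
    ∏ i ∈ t, f (v - b i) / f (v - u i) =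
      ∑ a ∈ t, f (v - u a + ∑ i ∈ t, (u i - b i)) / (f (∑ i ∈ t, (u i - b i)) * f (v - u a))
        * ((∏ i ∈ t, f (u a - b i)) / ∏ i ∈ t.erase a, f (u a - u i)) := by
  induction ht using Finset.Nonempty.cons_induction generalizing b v with
  | singleton c =>
    have hvc := hv c (by simp)
    simp only [Finset.sum_singleton, Finset.prod_singleton] at hs ⊢
    simp only [Finset.erase_singleton, Finset.prod_empty, div_one, sub_add_sub_cancel]
    field_simp
  | cons c t hc ht ih =>
    have hut : ∀ a ∈ t, ∀ j ∈ t, a ≠ j → f (u a - u j) ≠ 0 :=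
      fun a ha j hj ↦ hu a (by simp [ha]) j (by simp [hj])
    have hut' : ∀ a ∈ t, f (u a - u c) ≠ 0 := fun a ha ↦
      hu a (by simp [ha]) c (by simp) (fun h ↦ hc (h ▸ ha))
    have huc : ∀ a ∈ t, f (u c - u a) ≠ 0 := fun a ha ↦
      hu c (by simp) a (by simp [ha]) (fun h ↦ hc (h ▸ ha))
    have hvt : ∀ a ∈ t, f (v - u a) ≠ 0 := fun a ha ↦ hv a (by simp [ha])
    have hvc : f (v - u c) ≠ 0 := hv c (by simp)
    -- the step when the partial sum over `t` is already generic
    have step (b : ι → ℂ) (hs : f (∑ i ∈ Finset.cons c t hc, (u i - b i)) ≠ 0)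
        (hst : f (∑ i ∈ t, (u i - b i)) ≠ 0) :
        ∏ i ∈ Finset.cons c t hc, f (v - b i) / f (v - u i) =
          ∑ a ∈ Finset.cons c t hc, f (v - u a + ∑ i ∈ Finset.cons c t hc, (u i - b i)) /
            (f (∑ i ∈ Finset.cons c t hc, (u i - b i)) * f (v - u a))
            * ((∏ i ∈ Finset.cons c t hc, f (u a - b i)) /
              ∏ i ∈ (Finset.cons c t hc).erase a, f (u a - u i)) := by
      have hsum : ∑ i ∈ Finset.cons c t hc, (u i - b i) =
          (∑ i ∈ t, (u i - b i)) + u c - b c := by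
        rw [Finset.sum_cons]
        ring
      have ihv := ih hut b hst v hvt
      have ihc := ih hut b hst (u c) huc
      rw [hsum] at hs ⊢
      set s := ∑ i ∈ t, (u i - b i)
      rw [Finset.prod_div_distrib] at ihc
      rw [Finset.prod_cons, Finset.sum_cons, Finset.prod_cons, Finset.erase_cons, mul_div_assoc,
        ihc, ihv, Finset.mul_sum, Finset.mul_sum, Finset.mul_sum, ← Finset.sum_add_distrib]
      refine Finset.sum_congr rfl fun a ha ↦ ?_
      have hca : c ≠ a := fun h ↦ hc (h ▸ ha)
      rw [Finset.prod_cons, Finset.erase_cons_of_ne _ hca, Finset.prod_cons, mul_div_mul_comm]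
      linear_combination ((∏ i ∈ t, f (u a - b i)) / ∏ i ∈ t.erase a, f (u a - u i)) *
        partialFraction_two_poles hneg hthree hst hs (hvt a ha) hvc (hut' a ha)
    -- in general, shift two of the `b i` in opposite directions
    obtain ⟨d, hd⟩ := ht
    have hdc : c ≠ d := fun h ↦ hc (h ▸ hd)
    let β (τ : ℂ) (i : ι) : ℂ := b i + (if i = c then τ else 0) - (if i = d then τ else 0)
    have hβc (τ : ℂ) : ∑ i ∈ Finset.cons c t hc, (u i - β τ i) =
        ∑ i ∈ Finset.cons c t hc, (u i - b i) := by
      have : ∀ i, u i - β τ i =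
          (u i - b i) - (if i = c then τ else 0) + (if i = d then τ else 0) := fun i ↦ by
        simp only [β]; ring
      simp [this, Finset.sum_add_distrib, Finset.sum_sub_distrib, hd]
    have hβt (τ : ℂ) : ∑ i ∈ t, (u i - β τ i) = ∑ i ∈ t, (u i - b i) + τ := by
      have : ∀ i, u i - β τ i =
          (u i - b i) - (if i = c then τ else 0) + (if i = d then τ else 0) := fun i ↦ by
        simp only [β]; ring
      simp [this, Finset.sum_add_distrib, Finset.sum_sub_distrib, hd, hc]
    have hβ (i : ι) : Continuous fun τ ↦ β τ i := by
      simp only [β]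
      split_ifs <;> fun_prop
    have hD : Dense {τ | f (∑ i ∈ t, (u i - b i) + τ) ≠ 0} :=
      hdense.preimage (Homeomorph.addLeft (∑ i ∈ t, (u i - b i))).isOpenMap
    have hEq : (fun τ ↦ ∏ i ∈ Finset.cons c t hc, f (v - β τ i) / f (v - u i)) =
        fun τ ↦ ∑ a ∈ Finset.cons c t hc, f (v - u a + ∑ i ∈ Finset.cons c t hc, (u i - b i)) /
          (f (∑ i ∈ Finset.cons c t hc, (u i - b i)) * f (v - u a))
          * ((∏ i ∈ Finset.cons c t hc, f (u a - β τ i)) /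
            ∏ i ∈ (Finset.cons c t hc).erase a, f (u a - u i)) := by
      refine Continuous.ext_on hD ?_ ?_ fun τ hτ ↦ ?_
      · exact continuous_finsetProd _ fun i _ ↦
          (hcont.comp (continuous_const.sub (hβ i))).div_const _
      · exact continuous_finsetSum _ fun a _ ↦ continuous_const.mul
          ((continuous_finsetProd _ fun i _ ↦
            hcont.comp (continuous_const.sub (hβ i))).div_const _)
      · have := step (β τ) (by rwa [hβc]) (by rwa [hβt])
        rwa [hβc] at this
    simpa [β] using congrFun hEq 0

end PartialFraction

theorem elliptic_partial_fraction (q r : ℝ) (hq0 : 0 < q) (hq1 : q < 1) (hr : 0 < r)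
    (n m : ℕ) (hn : 1 ≤ n) (hm : m ≤ n) (v : ℂ) (u : ℕ → ℂ)
    (hgen : br q r (2 * (m : ℂ) - (n : ℂ)) ≠ 0)
    (hv : ∀ a ∈ Finset.Icc 1 n, br q r (v - u a) ≠ 0)
    (hu : ∀ a ∈ Finset.Icc 1 n, ∀ j ∈ Finset.Icc 1 n, a ≠ j → br q r (u a - u j) ≠ 0) :
    (∏ k ∈ Finset.Icc 1 m, br q r (v - u k + 1) / br q r (v - u k)) *
      (∏ l ∈ Finset.Icc (m + 1) n, br q r (v - u l - 1) / br q r (v - u l))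
    = ∑ a ∈ Finset.Icc 1 n,
        br q r (v - u a + (2 * (m : ℂ) - (n : ℂ)))
          / (br q r (2 * (m : ℂ) - (n : ℂ)) * br q r (v - u a))
        * ((∏ k ∈ Finset.Icc 1 m, br q r (u a - u k + 1))
            * (∏ l ∈ Finset.Icc (m + 1) n, br q r (u a - u l - 1))
            / ∏ j ∈ (Finset.Icc 1 n).erase a, br q r (u a - u j)) := by
  set b : ℕ → ℂ := fun i ↦ if i ≤ m then u i - 1 else u i + 1
  have hlow : ∀ i ∈ Finset.Icc 1 m, b i = u i - 1 := fun i hi ↦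
    if_pos (Finset.mem_Icc.mp hi).2
  have hhigh : ∀ i ∈ Finset.Icc (m + 1) n, b i = u i + 1 := fun i hi ↦
    if_neg (by have := (Finset.mem_Icc.mp hi).1; omega)
  have hdisj : Disjoint (Finset.Icc 1 m) (Finset.Icc (m + 1) n) :=
    Finset.disjoint_left.mpr fun i h1 h2 ↦ by
      simp only [Finset.mem_Icc] at h1 h2
      omega
  have hunion : Finset.Icc 1 n = Finset.Icc 1 m ∪ Finset.Icc (m + 1) n := by
    ext i
    simp only [Finset.mem_union, Finset.mem_Icc]
    omega
  have hsum : ∑ i ∈ Finset.Icc 1 n, (u i - b i) = 2 * (m : ℂ) - n := by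
    rw [hunion, Finset.sum_union hdisj,
      Finset.sum_congr rfl fun i hi ↦ show u i - b i = 1 by rw [hlow i hi]; ring,
      Finset.sum_congr rfl fun i hi ↦ show u i - b i = -1 by rw [hhigh i hi]; ring]
    simp only [Finset.sum_const, Nat.card_Icc, nsmul_eq_mul, Nat.add_sub_cancel,
      Nat.add_sub_add_right, Nat.cast_sub hm]
    ring
  have hprod (x : ℂ) : ∏ i ∈ Finset.Icc 1 n, br q r (x - b i) =
      (∏ k ∈ Finset.Icc 1 m, br q r (x - u k + 1)) *
        ∏ l ∈ Finset.Icc (m + 1) n, br q r (x - u l - 1) := by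
    rw [hunion, Finset.prod_union hdisj]
    congr 1
    · exact Finset.prod_congr rfl fun i hi ↦ by rw [hlow i hi, ← sub_add]
    · exact Finset.prod_congr rfl fun i hi ↦ by rw [hhigh i hi, sub_sub]
  have main := partialFraction_of_three_term (differentiable_br hq0 hq1 hr).continuous
    (dense_br_ne_zero hq0 hq1 hr hgen) (br_neg hq0 hq1 hr) (br_three_term hq0 hq1 hr)
    (Finset.nonempty_Icc.mpr hn) u hu b (by rwa [hsum]) v hv
  simp only [hsum, hprod, Finset.prod_div_distrib] at main
  rw [Finset.prod_div_distrib, Finset.prod_div_distrib, div_mul_div_comm,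
    ← Finset.prod_union hdisj (f := fun i ↦ br q r (v - u i)), ← hunion]
  exact main
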